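/- arXiv:2204.06303 — 3 statements merged into one kernel-verified Lean document; each statement's English description precedes it below -/
import Mathlib

section
/- Let A be a commutative ring, ℓ a natural number, and f₀, …, f_ℓ ∈ A[t₀, …, t_ℓ]. Assume there exist a ∈ A, g₀ ∈ A, and g_i ∈ A[t₀, …, t_{i−1}] for 0 < i ≤ ℓ such that f_i = a·t_i − g_i(t₀, …, t_{i−1}) for all i = 0, …, ℓ. Let B = A[t₀, …, t_ℓ]/(f₀, …, f_ℓ). Then the canonical ring homomorphism φ : A → B induces an isomorphism φ_a : A_a ≅ B_{φ(a)} between the localizations at the multiplicative sets {1, a, a², …} and {1, φ(a), φ(a)², …} respectively. -/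
open MvPolynomial in
theorem exists_solution_aux {A S : Type} [CommRing A] [CommRing S] [Algebra A S] (n : ℕ) (u : S)
    (g : Fin n → MvPolynomial (Fin n) A) (hg : ∀ i, ∀ j ∈ (g i).vars, j < i) :
    ∃ c : Fin n → S, ∀ i, c i = u * aeval c (g i) := by
  let F : (i : Fin n) → ((j : Fin n) → j < i → S) → S :=
    fun i c => u * aeval (fun j => if h : j < i then c j h else 0) (g i)
  refine ⟨(wellFounded_lt (α := Fin n)).fix F, fun i => ?_⟩
  rw [WellFounded.fix_eq]
  change u * _ = _
  congr 1
  refine eval₂Hom_congr' rfl (fun j hj _ => ?_) rfl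
  rw [dif_pos (hg i j hj)]

open MvPolynomial in
theorem unique_solution_aux {A S : Type} [CommRing A] [CommRing S] [Algebra A S] (n : ℕ) (a : S)
    (ha : IsUnit a)
    (g : Fin n → MvPolynomial (Fin n) A) (hg : ∀ i, ∀ j ∈ (g i).vars, j < i)
    (c d : Fin n → S) (hc : ∀ i, a * c i = aeval c (g i)) (hd : ∀ i, a * d i = aeval d (g i)) :
    c = d := by
  funext i
  induction i using WellFoundedLT.induction with
  | ind i ih =>
    apply ha.mul_left_cancel
    rw [hc, hd]
    exact eval₂Hom_congr' rfl (fun j hj _ => ih j (hg i j hj)) rfl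

/-- **Lemma.** Let `A` be a commutative ring and `f₀, …, f_ℓ ∈ A[t₀, …, t_ℓ]` of the form
`f_i = a·t_i − g_i(t₀, …, t_{i−1})` with `a ∈ A` and `g_i` involving only the variables
`t_j` with `j < i` (so `g₀ ∈ A`).  Let `B = A[t₀, …, t_ℓ]/(f₀, …, f_ℓ)`.  Then the canonical
homomorphism `A → B` induces an isomorphism `A_a ≅ B_{φ(a)}` of the localizations away from
`a` and its image. -/
theorem localization_away_bijective (A : Type) [CommRing A] (ℓ : ℕ) (a : A)
    (f g : Fin (ℓ + 1) → MvPolynomial (Fin (ℓ + 1)) A)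
    (hg : ∀ i, ∀ j ∈ (g i).vars, j < i)
    (hf : ∀ i, f i = MvPolynomial.C a * MvPolynomial.X i - g i) :
    Function.Bijective
      (Localization.awayMap
        (algebraMap A (MvPolynomial (Fin (ℓ + 1)) A ⧸ Ideal.span (Set.range f))) a) := by
  set I := Ideal.span (Set.range f) with hI
  set B := MvPolynomial (Fin (ℓ + 1)) A ⧸ I
  set b : B := algebraMap A B a with hb
  set θ := Localization.awayMap (algebraMap A B) a with hθ
  have hθa : ∀ x : A, θ (algebraMap A _ x) = algebraMap A (Localization.Away b) x := by
    intro x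
    rw [hθ, Localization.awayMap, IsLocalization.Away.map, IsLocalization.map_eq]
    rfl
  have hau : IsUnit (algebraMap A (Localization.Away a) a) :=
    IsLocalization.Away.algebraMap_isUnit a
  have hbu : IsUnit (algebraMap A (Localization.Away b) a) :=
    IsLocalization.Away.algebraMap_isUnit b
  obtain ⟨c, hc⟩ := exists_solution_aux (S := Localization.Away a) (ℓ + 1)
    (IsLocalization.Away.invSelf a) g hg
  have hc' : ∀ i, algebraMap A (Localization.Away a) a * c i = MvPolynomial.aeval c (g i) := by
    intro i
    conv_lhs => rw [hc i, ← mul_assoc, IsLocalization.Away.mul_invSelf, one_mul]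
  let ψ : B →ₐ[A] Localization.Away a := Ideal.Quotient.liftₐ I (MvPolynomial.aeval c) (by
    intro x hx
    have : I ≤ RingHom.ker (MvPolynomial.aeval (R := A) c) := by
      rw [hI, Ideal.span_le]
      rintro _ ⟨i, rfl⟩
      simp [hf, RingHom.mem_ker, hc']
    exact this hx)
  have hψ : ∀ p, ψ (Ideal.Quotient.mk I p) = MvPolynomial.aeval c p := fun p => rfl
  have hψb : IsUnit (ψ.toRingHom b) := by
    have : ψ.toRingHom b = algebraMap A _ a := ψ.commutes a
    rw [this]; exact hau
  let η : Localization.Away b →+* Localization.Away a := IsLocalization.Away.lift b hψb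
  have hη : ∀ x : B, η (algebraMap B _ x) = ψ x := fun x => IsLocalization.Away.lift_eq b hψb x
  have h1 : η.comp θ = RingHom.id _ := by
    apply IsLocalization.ringHom_ext (Submonoid.powers a)
    ext x
    simp only [RingHom.comp_apply, RingHom.id_apply, hθa]
    rw [IsScalarTower.algebraMap_apply A B, hη, ψ.commutes]
  let θ' : Localization.Away a →ₐ[A] Localization.Away b := { θ with commutes' := hθa }
  let q : MvPolynomial (Fin (ℓ + 1)) A →ₐ[A] Localization.Away b :=
    (IsScalarTower.toAlgHom A B _).comp (Ideal.Quotient.mkₐ A I)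
  have hq : ∀ p, q p = algebraMap B _ (Ideal.Quotient.mk I p) := fun p => rfl
  have hX : (fun i => θ' (c i)) = fun i => q (MvPolynomial.X i) := by
    apply unique_solution_aux (ℓ + 1) _ hbu g hg
    · intro i
      have := congrArg θ' (hc' i)
      rw [map_mul, θ'.commutes] at this
      rw [this, ← MvPolynomial.comp_aeval_apply]
    · intro i
      have h2 : q (f i) = 0 := by
        rw [hq, Ideal.Quotient.eq_zero_iff_mem.mpr (Ideal.subset_span (Set.mem_range_self i)), map_zero]
      rw [hf, map_sub, map_mul, ← MvPolynomial.algebraMap_eq, q.commutes, sub_eq_zero] at h2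
      rw [h2, ← MvPolynomial.comp_aeval_apply, MvPolynomial.aeval_X_left_apply]
  have h3 : θ'.comp (MvPolynomial.aeval c) = q := by
    apply MvPolynomial.algHom_ext
    intro i
    simpa using congrFun hX i
  have h2 : θ.comp η = RingHom.id _ := by
    apply IsLocalization.ringHom_ext (Submonoid.powers b)
    refine RingHom.ext fun x => ?_
    obtain ⟨p, rfl⟩ := Ideal.Quotient.mk_surjective x
    simp only [RingHom.comp_apply, RingHom.id_apply, hη, hψ]
    exact DFunLike.congr_fun h3 p
  exact ⟨Function.LeftInverse.injective (g := η) fun x => DFunLike.congr_fun h1 x,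
    Function.RightInverse.surjective (g := η) fun x => DFunLike.congr_fun h2 x⟩
end

section
/- Assume the Hermite ring conjecture holds, i.e. for every commutative Hermite ring A the polynomial ring A[t] is Hermite. Let B = ⊕_{n∈ℕ} B_n be an ℕ-graded commutative ring with degree-0 part B₀. Then every finitely generated stably free B-module is extended from B₀, i.e. isomorphic to B ⊗_{B₀} P₀ for some B₀-module P₀. -/
open Polynomial

/-- A finitely generated module `P` over `A` is stably free if `P ⊕ Aᵐ ≅ Aⁿ` for some `m, n`. -/
def IsStablyFree (A : Type) [CommRing A] (P : Type) [AddCommGroup P] [Module A P] : Prop :=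
  ∃ m n : ℕ, Nonempty ((P × (Fin m → A)) ≃ₗ[A] (Fin n → A))

/-- A commutative ring is Hermite if all finitely generated stably free modules are free. -/
def IsHermite (A : Type) [CommRing A] : Prop :=
  ∀ (P : Type) [AddCommGroup P] [Module A P] [Module.Finite A P],
    IsStablyFree A P → Module.Free A P

theorem aux_lift {R L : Type} [CommRing R] [CommRing L] [Algebra R L] (S : Submonoid R)
    [IsLocalization S L] {ι : Type} [Finite ι] (q : ι → L[X]) (r : ι → R)
    (hr : ∀ i, (q i).coeff 0 = algebraMap R L (r i)) :
    ∃ s ∈ S, ∃ p : ι → R[X], ∀ i,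
      (p i).map (algebraMap R L) = (q i).comp (C (algebraMap R L s) * X) ∧
      (p i).coeff 0 = r i := by
  let _ := Polynomial.algebra R L
  have : IsLocalization (S.map C) L[X] := Polynomial.isLocalization S L
  obtain ⟨⟨b, s, hs, rfl⟩, hb⟩ := IsLocalization.exist_integer_multiples_of_finite (S.map C) q
  choose p hp using hb
  have hp' : ∀ i n, algebraMap R L ((p i).coeff n) = algebraMap R L s * (q i).coeff n := by
    intro i n
    have := congrArg (fun t => Polynomial.coeff t n) (hp i)
    have h2 : ∀ a : R[X], algebraMap R[X] L[X] a = a.map (algebraMap R L) := fun a => rfl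
    simpa [Algebra.smul_def, h2] using this
  refine ⟨s, hs, fun i => C (r i) + X * ((p i).divX.comp (C s * X)), fun i => ⟨?_, by simp⟩⟩
  ext n
  cases n with
  | zero => simp [hr]
  | succ n =>
    simp only [coeff_map, coeff_add, coeff_C_succ, coeff_X_mul, comp_C_mul_X_coeff, coeff_divX,
      zero_add, map_mul, map_pow, hp', pow_succ]
    ring

theorem aux_kill {R L : Type} [CommRing R] [CommRing L] [Algebra R L] (S : Submonoid R)
    [IsLocalization S L] {ι : Type} [Finite ι] (p : ι → R[X])
    (h0 : ∀ i, (p i).coeff 0 = 0) (h : ∀ i, (p i).map (algebraMap R L) = 0) :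
    ∃ s ∈ S, ∀ i, (p i).comp (C s * X) = 0 := by
  let _ := Polynomial.algebra R L
  have : IsLocalization (S.map C) L[X] := Polynomial.isLocalization S L
  cases nonempty_fintype ι
  have : ∀ i, ∃ s ∈ S, C s * p i = 0 := by
    intro i
    obtain ⟨⟨_, s, hs, rfl⟩, hb⟩ := (IsLocalization.map_eq_zero_iff (S.map C) L[X] (p i)).1 (h i)
    exact ⟨s, hs, hb⟩
  choose s hs hk using this
  refine ⟨∏ i, s i, Submonoid.prod_mem _ fun i _ => hs i, fun i => ?_⟩
  ext n
  cases n with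
  | zero => rw [comp_C_mul_X_coeff, h0]; simp
  | succ n =>
    obtain ⟨c, hc⟩ := Finset.dvd_prod_of_mem s (Finset.mem_univ i)
    have := congrArg (fun t => Polynomial.coeff t (n+1)) (hk i)
    simp only [coeff_C_mul, coeff_zero] at this
    rw [comp_C_mul_X_coeff, coeff_zero, hc, pow_succ]
    linear_combination (s i * c)^n * c * this

def MEqv {R : Type} [CommRing R] {m n : ℕ} (M₁ M₂ : Matrix (Fin m) (Fin n) R) : Prop :=
  ∃ G H : Matrix (Fin n) (Fin n) R, G * H = 1 ∧ M₁ = M₂ * G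

theorem MEqv.refl {R : Type} [CommRing R] {m n : ℕ} (M : Matrix (Fin m) (Fin n) R) :
    MEqv M M := ⟨1, 1, by simp, by simp⟩

theorem MEqv.trans {R : Type} [CommRing R] {m n : ℕ} {M₁ M₂ M₃ : Matrix (Fin m) (Fin n) R}
    (h : MEqv M₁ M₂) (h' : MEqv M₂ M₃) : MEqv M₁ M₃ := by
  obtain ⟨G, H, h1, rfl⟩ := h
  obtain ⟨G', H', h1', rfl⟩ := h'
  refine ⟨G' * G, H * H', ?_, by simp [Matrix.mul_assoc]⟩
  rw [Matrix.mul_assoc, ← Matrix.mul_assoc G, h1, Matrix.one_mul, h1']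

theorem MEqv.map {R T : Type} [CommRing R] [CommRing T] (f : R →+* T) {m n : ℕ}
    {M₁ M₂ : Matrix (Fin m) (Fin n) R}
    (h : MEqv M₁ M₂) : MEqv (M₁.map f) (M₂.map f) := by
  obtain ⟨G, H, h1, rfl⟩ := h
  refine ⟨G.map f, H.map f, ?_, by simp⟩
  rw [← Matrix.map_mul, h1, Matrix.map_one _ f.map_zero f.map_one]

/-- Patching step. -/
theorem aux_patch {R L : Type} [CommRing R] [CommRing L] [Algebra R L] (S : Submonoid R)
    [IsLocalization S L] {m n : ℕ} (M₁ M₂ : Matrix (Fin m) (Fin n) R[X])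
    (h0 : M₁.map (constantCoeff) = M₂.map (constantCoeff))
    (G H : Matrix (Fin n) (Fin n) L[X]) (hGH : G * H = 1)
    (hG : G.map constantCoeff = 1) (hM : M₁.map (mapRingHom (algebraMap R L)) =
      M₂.map (mapRingHom (algebraMap R L)) * G) :
    ∃ s ∈ S, MEqv (M₁.map (compRingHom (C s * X))) (M₂.map (compRingHom (C s * X))) := by
  have hH : H.map constantCoeff = 1 := by
    have := congrArg (fun A => A.map (constantCoeff (R := L))) hGH
    simpa [Matrix.map_mul, hG] using this
  obtain ⟨s, hs, p, hp⟩ := aux_lift (L := L) S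
    (fun x : (Fin n × Fin n) ⊕ (Fin n × Fin n) =>
      Sum.elim (fun x => G x.1 x.2) (fun x => H x.1 x.2) x)
    (Sum.elim (fun x => (1 : Matrix _ _ R) x.1 x.2) (fun x => (1 : Matrix _ _ R) x.1 x.2)) (by
      rintro (⟨i, j⟩ | ⟨i, j⟩)
      · have := congrFun (congrFun hG i) j
        simp only [Matrix.map_apply, constantCoeff_apply] at this
        simp only [Sum.elim_inl, this, Matrix.one_apply]
        split_ifs <;> simp
      · have := congrFun (congrFun hH i) j
        simp only [Matrix.map_apply, constantCoeff_apply] at this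
        simp only [Sum.elim_inr, this, Matrix.one_apply]
        split_ifs <;> simp)
  set G' : Matrix (Fin n) (Fin n) R[X] := Matrix.of fun i j => p (.inl (i, j)) with hG'
  set H' : Matrix (Fin n) (Fin n) R[X] := Matrix.of fun i j => p (.inr (i, j)) with hH'
  have g1 : G'.map (mapRingHom (algebraMap R L)) = G.map (compRingHom (C (algebraMap R L s) * X)) := by
    ext1 i j; exact (hp (.inl (i, j))).1
  have k1 : H'.map (mapRingHom (algebraMap R L)) = H.map (compRingHom (C (algebraMap R L s) * X)) := by
    ext1 i j; exact (hp (.inr (i, j))).1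
  have g2 : G'.map constantCoeff = 1 := by
    ext1 i j; exact (hp (.inl (i, j))).2
  have k2 : H'.map constantCoeff = 1 := by
    ext1 i j; exact (hp (.inr (i, j))).2
  have comm : ∀ M : Matrix (Fin m) (Fin n) R[X], (M.map (compRingHom (C s * X))).map
      (mapRingHom (algebraMap R L)) = (M.map (mapRingHom (algebraMap R L))).map
        (compRingHom (C (algebraMap R L s) * X)) := by
    intro M; ext1 i j; simp [Polynomial.map_comp]
  have comm0 : ∀ M : Matrix (Fin m) (Fin n) R[X], (M.map (compRingHom (C s * X))).map
      constantCoeff = M.map constantCoeff := by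
    intro M; ext1 i j; simp
  set D := G' * H' - 1 with hD
  set E := M₁.map (compRingHom (C s * X)) - M₂.map (compRingHom (C s * X)) * G' with hE
  have mone : ∀ {R T : Type} [CommRing R] [CommRing T] (f : R →+* T),
    (1 : Matrix (Fin n) (Fin n) R).map f = 1 := fun f => Matrix.map_one _ f.map_zero f.map_one
  have msub : ∀ {R T : Type} [CommRing R] [CommRing T] (f : R →+* T) {a b : ℕ}
    (A B : Matrix (Fin a) (Fin b) R), (A - B).map f = A.map f - B.map f :=
      fun f _ _ A B => Matrix.map_sub _ (map_sub f) A B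
  have hD0 : D.map constantCoeff = 0 := by
    rw [hD, msub, Matrix.map_mul, g2, k2, mone]; simp
  have hE0 : E.map constantCoeff = 0 := by
    rw [hE, msub, Matrix.map_mul, g2, comm0, comm0, h0]; simp
  have hD1 : D.map (mapRingHom (algebraMap R L)) = 0 := by
    rw [hD, msub, Matrix.map_mul, g1, k1, mone, ← Matrix.map_mul, hGH, mone]; simp
  have hE1 : E.map (mapRingHom (algebraMap R L)) = 0 := by
    rw [hE, msub, Matrix.map_mul, g1, comm, comm, ← Matrix.map_mul, hM]; simp
  obtain ⟨t, ht, hk⟩ := aux_kill (L := L) S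
    (fun x : (Fin n × Fin n) ⊕ (Fin m × Fin n) =>
      Sum.elim (fun x => D x.1 x.2) (fun x => E x.1 x.2) x) (by
      rintro (⟨i, j⟩ | ⟨i, j⟩)
      · exact congrFun (congrFun hD0 i) j
      · exact congrFun (congrFun hE0 i) j) (by
      rintro (⟨i, j⟩ | ⟨i, j⟩)
      · exact congrFun (congrFun hD1 i) j
      · exact congrFun (congrFun hE1 i) j)
  have hD2 : D.map (compRingHom (C t * X)) = 0 := by
    ext1 i j; exact hk (.inl (i, j))
  have hE2 : E.map (compRingHom (C t * X)) = 0 := by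
    ext1 i j; exact hk (.inr (i, j))
  rw [hD, msub, Matrix.map_mul, mone, sub_eq_zero] at hD2
  rw [hE, msub, Matrix.map_mul, sub_eq_zero] at hE2
  have cc : ∀ M : Matrix (Fin m) (Fin n) R[X], (M.map (compRingHom (C s * X))).map
      (compRingHom (C t * X)) = M.map (compRingHom (C (s * t) * X)) := by
    intro M; ext1 i j; simp [Polynomial.comp_assoc, mul_assoc]
  rw [cc, cc] at hE2
  exact ⟨s * t, S.mul_mem hs ht, _, _, hD2, hE2⟩

/-- A split surjection decomposes its source. -/
def splitEquiv {R V W : Type} [CommRing R] [AddCommGroup V] [Module R V] [AddCommGroup W]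
    [Module R W] (f : V →ₗ[R] W) (g : W →ₗ[R] V) (h : ∀ w, f (g w) = w) :
    (LinearMap.ker f × W) ≃ₗ[R] V where
  toFun x := x.1 + g x.2
  map_add' x y := by simp; abel
  map_smul' r x := by simp
  invFun v := (⟨v - g (f v), by simp [h]⟩, f v)
  left_inv x := by
    rcases x with ⟨⟨k, hk⟩, w⟩
    have hk' : f k = 0 := hk
    simp [h, hk']
  right_inv v := by simp

theorem splitEquiv_apply {R V W : Type} [CommRing R] [AddCommGroup V] [Module R V]
    [AddCommGroup W] [Module R W] (f : V →ₗ[R] W) (g : W →ₗ[R] V) (h : ∀ w, f (g w) = w)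
    (x) : f (splitEquiv f g h x) = x.2 := by
  rcases x with ⟨⟨k, hk⟩, w⟩
  have hk' : f k = 0 := hk
  simp [splitEquiv, h, hk']

theorem hermite_of_local (A : Type) [CommRing A] [IsLocalRing A] : IsHermite A := by
  intro P _ _ _ ⟨m, n, ⟨e⟩⟩
  have : Module.Projective A P :=
    Module.Projective.of_split (e.toLinearMap ∘ₗ LinearMap.inl A P (Fin m → A))
      (LinearMap.fst A P (Fin m → A) ∘ₗ e.symm.toLinearMap) (by ext; simp)
  exact Module.free_of_flat_of_isLocalRing

theorem mulVec_right_inv {R : Type} [CommRing R] {m n : ℕ} (M : Matrix (Fin m) (Fin n) R)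
    (N : Matrix (Fin n) (Fin m) R) (h : M * N = 1) (w) : M.mulVecLin (N.mulVecLin w) = w := by
  simp [h]

theorem ker_free {R : Type} [CommRing R] [Nontrivial R] (hR : IsHermite R) {m n : ℕ}
    (M : Matrix (Fin m) (Fin n) R) (N : Matrix (Fin n) (Fin m) R) (h : M * N = 1) :
    Nonempty ((Fin (n - m) → R) ≃ₗ[R] LinearMap.ker M.mulVecLin) := by
  let e := splitEquiv M.mulVecLin N.mulVecLin (mulVec_right_inv M N h)
  have fin : Module.Finite R (LinearMap.ker M.mulVecLin) :=
    Module.Finite.of_surjective (LinearMap.fst R _ _ ∘ₗ e.symm.toLinearMap)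
      (Prod.fst_surjective.comp e.symm.surjective)
  have free : Module.Free R (LinearMap.ker M.mulVecLin) := hR _ ⟨m, n, ⟨e⟩⟩
  have hr := e.finrank_eq
  rw [Module.finrank_prod] at hr
  simp only [Module.finrank_fintype_fun_eq_card, Fintype.card_fin] at hr
  refine ⟨LinearEquiv.ofFinrankEq _ _ ?_⟩
  simp only [Module.finrank_fintype_fun_eq_card, Fintype.card_fin]
  omega

theorem meqv_of_hermite {R : Type} [CommRing R] [Nontrivial R] (hR : IsHermite R) {m n : ℕ}
    (M₁ M₂ : Matrix (Fin m) (Fin n) R) (N₁ N₂ : Matrix (Fin n) (Fin m) R)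
    (h₁ : M₁ * N₁ = 1) (h₂ : M₂ * N₂ = 1) : MEqv M₁ M₂ := by
  obtain ⟨k₁⟩ := ker_free hR M₁ N₁ h₁
  obtain ⟨k₂⟩ := ker_free hR M₂ N₂ h₂
  let e₁ := splitEquiv M₁.mulVecLin N₁.mulVecLin (mulVec_right_inv M₁ N₁ h₁)
  let e₂ := splitEquiv M₂.mulVecLin N₂.mulVecLin (mulVec_right_inv M₂ N₂ h₂)
  let e : (Fin n → R) ≃ₗ[R] (Fin n → R) :=
    e₁.symm ≪≫ₗ ((k₁.symm ≪≫ₗ k₂).prodCongr (LinearEquiv.refl R _)) ≪≫ₗ e₂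
  have he : ∀ v, M₂.mulVecLin (e v) = M₁.mulVecLin v := by
    intro v
    obtain ⟨x, rfl⟩ := e₁.surjective v
    have a1 : M₁.mulVecLin (e₁ x) = x.2 := splitEquiv_apply _ _ _ x
    have a2 := splitEquiv_apply M₂.mulVecLin N₂.mulVecLin (mulVec_right_inv M₂ N₂ h₂)
      (((k₁.symm ≪≫ₗ k₂).prodCongr (LinearEquiv.refl R _)) x)
    rw [a1]
    simp only [e, LinearEquiv.trans_apply, LinearEquiv.symm_apply_apply]
    exact a2
  refine ⟨LinearMap.toMatrix' e.toLinearMap, LinearMap.toMatrix' e.symm.toLinearMap, ?_, ?_⟩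
  · rw [← LinearMap.toMatrix'_comp]; simp
  · apply Matrix.toLin'.injective
    ext1 i
    rw [Matrix.toLin'_mul, Matrix.toLin'_toMatrix']
    ext1
    simp only [LinearMap.comp_apply, Matrix.toLin'_apply]
    exact (he _).symm

/-- Equivalent matrices have isomorphic kernels. -/
theorem MEqv.kerEquiv {R : Type} [CommRing R] {m n : ℕ} {M₁ M₂ : Matrix (Fin m) (Fin n) R}
    (h : MEqv M₁ M₂) :
    Nonempty (LinearMap.ker M₁.mulVecLin ≃ₗ[R] LinearMap.ker M₂.mulVecLin) := by
  obtain ⟨G, H, h1, rfl⟩ := h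
  have h2 : H * G = 1 := mul_eq_one_comm.1 h1
  let e : (Fin n → R) ≃ₗ[R] (Fin n → R) := LinearEquiv.ofLinearMap G.mulVecLin H.mulVecLin
    (by rw [← Matrix.mulVecLin_mul, h1, Matrix.mulVecLin_one])
    (by rw [← Matrix.mulVecLin_mul, h2, Matrix.mulVecLin_one])
  refine ⟨e.ofSubmodules _ _ ?_⟩
  ext v
  rw [Submodule.mem_map_equiv, LinearMap.mem_ker, LinearMap.mem_ker]
  have : e.symm v = H.mulVec v := rfl
  rw [this]
  simp [h1]

/-- The substitution `t ↦ X + Y`. -/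
noncomputable def shiftHom (R : Type) [CommRing R] : R[X] →+* R[X][X] :=
  eval₂RingHom (C.comp C) (C X + X)

theorem map_one' {k : ℕ} {R T : Type} [CommRing R] [CommRing T] (f : R →+* T) :
    (1 : Matrix (Fin k) (Fin k) R).map f = 1 := Matrix.map_one _ f.map_zero f.map_one

theorem map_map' {a b : ℕ} {R T U : Type} [CommRing R] [CommRing T] [CommRing U] (p : R →+* T)
    (q : T →+* U) (M : Matrix (Fin a) (Fin b) R) : (M.map p).map q = M.map (q.comp p) := by
  ext1 i j; rfl

theorem local_step {A L : Type} [CommRing A] [CommRing L] [Algebra A L] (S : Submonoid A)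
    [IsLocalization S L] {m n : ℕ} (M : Matrix (Fin m) (Fin n) A[X])
    (h : MEqv (M.map (mapRingHom (algebraMap A L)))
      ((M.map (mapRingHom (algebraMap A L))).map (C.comp (evalRingHom 0)))) :
    ∃ s ∈ S, MEqv ((M.map (shiftHom A)).map (compRingHom (C (C s) * X)))
      ((M.map (C : A[X] →+* A[X][X])).map (compRingHom (C (C s) * X))) := by
  let f := algebraMap A L
  let c0 : L[X] →+* L[X] := C.comp (evalRingHom 0)
  let ML := M.map (mapRingHom f)
  obtain ⟨g, k, hgk, hg⟩ := h
  change ML = ML.map c0 * g at hg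
  have hkg : k * g = 1 := mul_eq_one_comm.1 hgk
  let shL : L[X] →+* L[X][X] := shiftHom L
  let shA : A[X] →+* A[X][X] := shiftHom A
  let cL : L[X] →+* L[X][X] := C
  let cA : A[X] →+* A[X][X] := C
  let _ := Polynomial.algebra A L
  have hloc : IsLocalization (S.map C) L[X] := Polynomial.isLocalization S L
  have hmap : algebraMap A[X] L[X] = mapRingHom f := rfl
  have cs : (mapRingHom (mapRingHom f)).comp shA = shL.comp (mapRingHom f) := by
    ext <;> simp [shiftHom, shA, shL]
  have cc : (mapRingHom (mapRingHom f)).comp cA = cL.comp (mapRingHom f) := by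
    ext <;> simp [cA, cL]
  have c00 : shL.comp c0 = cL.comp c0 := by
    ext <;> simp [shiftHom, shL, cL, c0]
  obtain ⟨_, ⟨s, hs, rfl⟩, hE⟩ := aux_patch (L := L[X]) (S.map C) (M.map shA) (M.map cA)
    (by
      rw [map_map', map_map']; congr 2
      ext <;> simp [shiftHom, shA, cA])
    (k.map cL * g.map shL) (k.map shL * g.map cL)
    (by
      rw [Matrix.mul_assoc, ← Matrix.mul_assoc (g.map shL), ← Matrix.map_mul, hgk, map_one',
        Matrix.one_mul, ← Matrix.map_mul, hkg, map_one'])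
    (by
      have : constantCoeff.comp shL = constantCoeff.comp cL := by ext <;> simp [shiftHom, shL, cL]
      rw [Matrix.map_mul, map_map', map_map', this, ← map_map', ← map_map', ← Matrix.map_mul, ← Matrix.map_mul, hkg,
        map_one', map_one'])
    (by
      rw [hmap, map_map', map_map', cs, cc, ← map_map', ← map_map']
      change ML.map shL = ML.map cL * _
      have t1 : ML.map cL * k.map cL = (ML.map c0).map cL := by
        rw [← Matrix.map_mul]
        conv_lhs => rw [hg]
        rw [Matrix.mul_assoc, hgk, Matrix.mul_one]
      rw [← Matrix.mul_assoc, t1, map_map' c0 cL ML, ← c00, ← map_map' c0 shL ML, ← Matrix.map_mul, ← hg])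
  exact ⟨s, hs, hE⟩

/-- Homotopy invariance: under the conjecture, `M(1) ~ M(0)`. -/
theorem homotopy (hH : ∀ (A : Type) [CommRing A], IsHermite A → IsHermite (Polynomial A))
    {A : Type} [CommRing A] {m n : ℕ} (M : Matrix (Fin m) (Fin n) A[X])
    (N : Matrix (Fin n) (Fin m) A[X]) (h : M * N = 1) :
    MEqv (M.map (evalRingHom 1)) (M.map (evalRingHom 0)) := by
  let J : Ideal A :=
    { carrier := {c | ∀ x y : A, MEqv (M.map (evalRingHom (x + c * y))) (M.map (evalRingHom x))}
      zero_mem' := by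
        intro x y
        simpa using MEqv.refl _
      add_mem' := by
        intro a b ha hb x y
        have := (hb (x + a * y) y).trans (ha x y)
        rwa [add_assoc, ← add_mul] at this
      smul_mem' := by
        intro r c hc x y
        have := hc x (r * y)
        rwa [show c * (r * y) = (r • c) * y by simp [smul_eq_mul]; ring] at this }
  suffices hJ : J = ⊤ by
    have h1 : (1 : A) ∈ J := hJ ▸ Submodule.mem_top
    simpa using h1 0 1
  by_contra hJ
  obtain ⟨𝔪, hmax, hle⟩ := Ideal.exists_le_maximal J hJ
  let L := Localization.AtPrime 𝔪
  let f : A →+* L := algebraMap A L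
  have hHL : IsHermite L[X] := hH L (hermite_of_local L)
  have mone : ∀ {k : ℕ} {R T : Type} [CommRing R] [CommRing T] (f : R →+* T),
    (1 : Matrix (Fin k) (Fin k) R).map f = 1 := fun f => Matrix.map_one _ f.map_zero f.map_one
  let ML := M.map (mapRingHom f)
  let NL := N.map (mapRingHom f)
  let c0 : L[X] →+* L[X] := C.comp (evalRingHom 0)
  have e1 : ML * NL = 1 := by simp only [ML, NL]; rw [← Matrix.map_mul, h, mone]
  have e2 : ML.map c0 * NL.map c0 = 1 := by rw [← Matrix.map_mul, e1, mone]
  obtain ⟨s, hs, hE⟩ := local_step 𝔪.primeCompl (L := L) M (meqv_of_hermite hHL ML (ML.map c0) NL (NL.map c0) e1 e2)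
  refine hs (hle ?_)
  intro x y
  have := hE.map ((evalRingHom x).comp (evalRingHom (C y)))
  rw [map_map', map_map', map_map', map_map'] at this
  convert this using 3
  · ext <;> simp [shiftHom]
  · ext <;> simp 
open TensorProduct in

/-- The kernel of a split surjection commutes with base change. -/
theorem ker_baseChange {R B : Type} [CommRing R] [CommRing B] [Algebra R B] {m n : ℕ}
    (M : Matrix (Fin m) (Fin n) R) (N : Matrix (Fin n) (Fin m) R) (h : M * N = 1) :
    Nonempty (LinearMap.ker (M.map (algebraMap R B)).mulVecLin ≃ₗ[B]
      TensorProduct R B (LinearMap.ker M.mulVecLin)) := by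
  let K := LinearMap.ker M.mulVecLin
  let pr : (Fin n → R) →ₗ[R] K := LinearMap.codRestrict K
    (LinearMap.id - N.mulVecLin ∘ₗ M.mulVecLin) (fun v => by
      simp [K, Matrix.mulVec_sub, ← Matrix.mul_assoc, h])
  have hpr : pr ∘ₗ K.subtype = LinearMap.id := by
    ext1 ⟨k, hk⟩
    have hk' : M.mulVec k = 0 := hk
    apply Subtype.ext
    simp [pr, hk']
  let σ := TensorProduct.piScalarRight R B B (Fin n)
  let i : TensorProduct R B K →ₗ[B] (Fin n → B) := σ.toLinearMap ∘ₗ K.subtype.baseChange B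
  let p : (Fin n → B) →ₗ[B] TensorProduct R B K := pr.baseChange B ∘ₗ σ.symm.toLinearMap
  have hi : ∀ k : K, i (1 ⊗ₜ[R] k) = algebraMap R B ∘ (k : Fin n → R) := by
    intro k; ext j; simp [i, σ, Algebra.smul_def]
  have hpi : p ∘ₗ i = LinearMap.id := by
    have : p ∘ₗ i = pr.baseChange B ∘ₗ K.subtype.baseChange B := by
      ext k; simp [p, i]
    rw [this, ← LinearMap.baseChange_comp, hpr, LinearMap.baseChange_id]
  have hmi : ∀ x, (M.map (algebraMap R B)).mulVecLin (i x) = 0 := by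
    have : (M.map (algebraMap R B)).mulVecLin ∘ₗ i = 0 := by
      apply TensorProduct.AlgebraTensorModule.curry_injective
      ext k j
      have hk : M.mulVec (k : Fin n → R) = 0 := k.2
      simp only [TensorProduct.AlgebraTensorModule.curry_apply, TensorProduct.curry_apply,
        LinearMap.coe_restrictScalars, LinearMap.comp_apply, hi, Matrix.mulVecLin_apply]
      rw [← RingHom.map_mulVec, hk]; simp
    exact fun x => LinearMap.congr_fun this x
  have hip : ∀ v, (M.map (algebraMap R B)).mulVecLin v = 0 → i (p v) = v := by
    have : i ∘ₗ p = LinearMap.id - (N.map (algebraMap R B)).mulVecLin ∘ₗ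
        (M.map (algebraMap R B)).mulVecLin := by
      ext1 j
      ext1
      have h1 : σ.symm (Pi.single j 1) = 1 ⊗ₜ[R] (Pi.single j 1) := by
        rw [LinearEquiv.symm_apply_eq]
        ext l
        simp [σ, Pi.single_apply]
      have h2 : (Pi.single j (1 : B)) = algebraMap R B ∘ (Pi.single j (1 : R)) := by
        ext l; simp [Pi.single_apply]
      simp only [LinearMap.comp_apply, LinearMap.single_apply, p, LinearEquiv.coe_coe, h1,
        LinearMap.baseChange_tmul, hi, LinearMap.sub_apply, Matrix.mulVecLin_apply,
        LinearMap.id_apply]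
      rw [h2]
      ext l
      rw [Pi.sub_apply]
      have h3 : (M.map (algebraMap R B)).mulVec (algebraMap R B ∘ (Pi.single j (1 : R))) =
        algebraMap R B ∘ (M.mulVec (Pi.single j 1)) := by
        ext l; exact (RingHom.map_mulVec _ _ _ _).symm
      rw [h3, ← RingHom.map_mulVec, Function.comp_apply, Function.comp_apply, ← map_sub]
      rfl
    intro v hv
    have := LinearMap.congr_fun this v
    simpa [hv] using this
  exact ⟨LinearEquiv.ofLinearMap (p ∘ₗ (LinearMap.ker _).subtype)
    (LinearMap.codRestrict _ i (fun x => hmi x))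
    (by apply LinearMap.ext; intro x; exact LinearMap.congr_fun hpi x)
    (by ext1 x; exact Subtype.ext (hip x.1 x.2))⟩

/-- The Swan–Weibel homomorphism `b ↦ ∑ bₙ tⁿ`. -/
noncomputable def weibelHom {B : Type} [CommRing B] (𝒜 : ℕ → AddSubgroup B) [GradedRing 𝒜] :
    B →+* B[X] :=
  (DirectSum.toSemiring
    (fun i => (monomial i : B →ₗ[B] B[X]).toAddMonoidHom.comp (𝒜 i).subtype)
    (by simp) (by intros; simp [monomial_mul_monomial])).comp
  (DirectSum.decomposeRingEquiv 𝒜 : B →+* _)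

theorem weibelHom_apply {B : Type} [CommRing B] (𝒜 : ℕ → AddSubgroup B) [GradedRing 𝒜]
    (i : ℕ) (b : 𝒜 i) : weibelHom 𝒜 b = monomial i (b : B) := by
  have : DirectSum.decomposeRingEquiv 𝒜 (b : B) = DirectSum.of (fun i => 𝒜 i) i b :=
    DirectSum.decompose_coe 𝒜 b
  simp only [weibelHom, RingHom.comp_apply, RingHom.coe_coe, this]
  exact DirectSum.toAddMonoid_of (β := fun i => 𝒜 i) (fun i =>
    (monomial i : B →ₗ[B] B[X]).toAddMonoidHom.comp (𝒜 i).subtype) i b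

theorem weibelHom_eval_one {B : Type} [CommRing B] (𝒜 : ℕ → AddSubgroup B) [GradedRing 𝒜] :
    (evalRingHom 1).comp (weibelHom 𝒜) = RingHom.id B := by
  ext b
  induction b using DirectSum.Decomposition.inductionOn 𝒜 with
  | zero => simp
  | homogeneous b => simp [weibelHom_apply]
  | add a b ha hb => rw [map_add, ha, hb, map_add]

theorem weibelHom_eval_zero {B : Type} [CommRing B] (𝒜 : ℕ → AddSubgroup B) [GradedRing 𝒜] (b : B) :
    (evalRingHom 0) (weibelHom 𝒜 b) ∈ SetLike.GradeZero.subring 𝒜 := by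
  induction b using DirectSum.Decomposition.inductionOn 𝒜 with
  | zero => simp
  | @homogeneous i b =>
    rw [weibelHom_apply]
    cases i with
    | zero => simp; exact b.2
    | succ i => simp
  | add a b ha hb => rw [map_add, map_add]; exact add_mem ha hb

theorem stablyFree_extended_of_hermiteConjecture
    (hH : ∀ (A : Type) [CommRing A], IsHermite A → IsHermite (Polynomial A))
    (B : Type) [CommRing B] (𝒜 : ℕ → AddSubgroup B) [GradedRing 𝒜]
    (P : Type) [AddCommGroup P] [Module B P] [Module.Finite B P]
    (hP : IsStablyFree B P) :
    ∃ (P₀ : Type) (_ : AddCommGroup P₀) (_ : Module (SetLike.GradeZero.subring 𝒜) P₀),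
      Nonempty (P ≃ₗ[B] TensorProduct (SetLike.GradeZero.subring 𝒜) B P₀) := by
  obtain ⟨m, n, ⟨e⟩⟩ := hP
  let fM : (Fin n → B) →ₗ[B] (Fin m → B) := LinearMap.snd B P _ ∘ₗ e.symm.toLinearMap
  let fN : (Fin m → B) →ₗ[B] (Fin n → B) := e.toLinearMap ∘ₗ LinearMap.inr B P _
  let M := LinearMap.toMatrix' fM
  let N := LinearMap.toMatrix' fN
  have hMN : M * N = 1 := by
    simp only [M, N]
    rw [← LinearMap.toMatrix'_comp]
    have : fM ∘ₗ fN = LinearMap.id := by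
      apply LinearMap.ext; intro v; simp [fM, fN]
    rw [this, LinearMap.toMatrix'_id]
  have hMf : M.mulVecLin = fM := Matrix.toLin'_toMatrix' fM
  have hPM : Nonempty (P ≃ₗ[B] LinearMap.ker M.mulVecLin) := by
    rw [hMf]
    exact ⟨LinearEquiv.ofLinearMap
      (LinearMap.codRestrict _ (e.toLinearMap ∘ₗ LinearMap.inl B P _) (by intro x; simp [fM]))
      (LinearMap.fst B P _ ∘ₗ e.symm.toLinearMap ∘ₗ (LinearMap.ker fM).subtype)
      (by
        ext1 ⟨x, hx⟩
        have hx' : (e.symm x).2 = 0 := hx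
        apply Subtype.ext
        have : ((e.symm x).1, (0 : Fin m → B)) = e.symm x := Prod.ext rfl hx'.symm
        change e ((e.symm x).1, (0 : Fin m → B)) = x
        rw [this, e.apply_symm_apply])
      (by
        ext1 x
        change (e.symm (e (x, 0))).1 = x
        rw [e.symm_apply_apply])⟩
  let φ := weibelHom 𝒜
  have hφ : M.map φ * N.map φ = 1 := by rw [← Matrix.map_mul, hMN, map_one']
  have key := homotopy hH (M.map φ) (N.map φ) hφ
  rw [map_map', weibelHom_eval_one, map_map'] at key
  let R₀ := SetLike.GradeZero.subring 𝒜
  let π : B →+* R₀ := ((evalRingHom 0).comp φ).codRestrict R₀ (weibelHom_eval_zero 𝒜)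
  have hπ : (evalRingHom 0).comp φ = (algebraMap R₀ B).comp π := by ext; rfl
  rw [hπ, ← map_map'] at key
  obtain ⟨e₁⟩ := hPM
  obtain ⟨e₂⟩ := key.kerEquiv
  obtain ⟨e₃⟩ := ker_baseChange (B := B) (M.map π) (N.map π)
    (by rw [← Matrix.map_mul, hMN, map_one'])
  have hid : M.map (RingHom.id B) = M := by ext; rfl
  rw [hid] at e₂
  exact ⟨_, _, _, ⟨e₁ ≪≫ₗ e₂ ≪≫ₗ e₃⟩⟩
end

section
/- Let r ≥ 2 be a natural number and let R = ℤ[1/r!]. Suppose that for all k, n ∈ ℕ, every unimodular row (a₀(t), …, a_r(t)) over B^R_{r,k,n}[t] with (a₀(0), …, a_r(0)) = (1, 0, …, 0) is completable. Then for every commutative ℤ[1/r!]-algebra A, every unimodular row (b₀(t), …, b_r(t)) over A[t] with (b₀(0), …, b_r(0)) = (1, 0, …, 0) is completable. -/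
open Polynomial


/-- Unimodular row: the entries generate the unit ideal. -/
def IsUnimodular {A : Type} [CommRing A] {n : ℕ} (v : Fin n → A) : Prop :=
  Ideal.span (Set.range v) = ⊤

/-- A row is completable if it occurs as a row of an invertible square matrix. -/
def IsCompletable {A : Type} [CommRing A] {n : ℕ} (v : Fin n → A) : Prop :=
  ∃ M : Matrix (Fin n) (Fin n) A, IsUnit M ∧ ∃ i, M i = v

/-- The set `S_{r,n}` of variables `x_{i,j}` (left summand) and `y_{i,j}` (right summand),
for `0 ≤ i ≤ r` and `0 ≤ j ≤ n`. -/
abbrev FinVars (r n : ℕ) : Type := (Fin (r + 1) × Fin (n + 1)) ⊕ (Fin (r + 1) × Fin (n + 1))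

/-- The polynomial `p_ℓ = Σ_{i=0}^r Σ_{j=0}^ℓ x_{i,j} y_{i,ℓ-j}` in `R[S_{r,n}]`. -/
noncomputable def pFin (R : Type) [CommRing R] (r n : ℕ) (ℓ : Fin (n + 1)) :
    MvPolynomial (FinVars r n) R :=
  ∑ i : Fin (r + 1), ∑ j : Fin (ℓ.1 + 1),
    MvPolynomial.X (Sum.inl (i, ⟨j.1, by have := j.isLt; have := ℓ.isLt; omega⟩)) *
    MvPolynomial.X (Sum.inr (i, ⟨ℓ.1 - j.1, by have := ℓ.isLt; omega⟩))

/-- The ideal of `R[S_{r,n}]` generated by the `p_ℓ` with `0 ≤ ℓ ≤ n`, `ℓ ≠ k`. -/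
noncomputable def JFin (R : Type) [CommRing R] (r k n : ℕ) :
    Ideal (MvPolynomial (FinVars r n) R) :=
  Ideal.span {q | ∃ ℓ : Fin (n + 1), (ℓ : ℕ) ≠ k ∧ q = pFin R r n ℓ}

/-- The ring `B^R_{r,k,n} = R[S_{r,n}]/(p₀, …, p̂_k, …, p_n)`. -/
def BFin (R : Type) [CommRing R] (r k n : ℕ) : Type :=
  MvPolynomial (FinVars r n) R ⧸ JFin R r k n

noncomputable instance (R : Type) [CommRing R] (r k n : ℕ) : CommRing (BFin R r k n) :=
  inferInstanceAs (CommRing (MvPolynomial (FinVars r n) R ⧸ JFin R r k n))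

theorem nak {D : Type} [CommRing D] (K : Ideal D) (hK : K ≤ Ideal.jacobson ⊥) (w : D[X])
    (hw : w.Monic) (N : Submodule D D[X]) (hN : ∀ g, w * g ∈ N)
    (h : ∀ f : D[X], f ∈ N ⊔ K • (⊤ : Submodule D D[X])) : N = ⊤ := by
  have key : degreeLT D w.natDegree ≤ N := by
    apply Submodule.le_of_le_smul_of_le_jacobson_bot (I := K) _ hK
    · intro f hf
      obtain ⟨n, hn, e, he, rfl⟩ := Submodule.mem_sup.1 (h f)
      have : e %ₘ w ∈ K • degreeLT D w.natDegree := by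
        have h1 : modByMonicHom w e ∈ (K • (⊤ : Submodule D D[X])).map (modByMonicHom w) :=
          Submodule.mem_map_of_mem he
        rw [Submodule.map_smul''] at h1
        refine Submodule.smul_mono le_rfl ?_ h1
        rintro _ ⟨g, -, rfl⟩
        rw [mem_degreeLT]
        rcases subsingleton_or_nontrivial D with hs | hs
        · rw [Subsingleton.elim (modByMonicHom w g) 0]; simp
        exact (degree_modByMonic_lt g hw).trans_le degree_le_natDegree
      rw [← modByMonic_add_div e w, ← add_assoc, add_right_comm]
      exact Submodule.add_mem_sup (N.add_mem hn (hN _)) this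
    · classical
      rw [degreeLT_eq_span_X_pow]
      exact ⟨_, rfl⟩
  rw [eq_top_iff]
  intro f _
  rw [← modByMonic_add_div f w]
  refine N.add_mem (key ?_) (hN _)
  rw [mem_degreeLT]
  rcases subsingleton_or_nontrivial D with hs | hs
  · rw [Subsingleton.elim (f %ₘ w) 0]; simp
  exact (degree_modByMonic_lt f hw).trans_le degree_le_natDegree

theorem smulTop {D : Type} [CommRing D] (K : Ideal D) (f : D[X]) :
    f ∈ K • (⊤ : Submodule D D[X]) ↔ f ∈ K.map (C : D →+* D[X]) := by
  rw [Ideal.smul_top_eq_map]; rfl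

theorem weier {D : Type} [CommRing D] (K : Ideal D) (hK : K ≤ Ideal.jacobson ⊥) (W x0 : D[X])
    (hW : W.Monic) (k : ℕ) (hx : x0 - W ∈ K.map (C : D →+* D[X])) :
    ∃ α v q : D[X], α ∈ K.map (C : D →+* D[X]) ∧ v ∈ K.map (C : D →+* D[X]) ∧
      q ∈ K.map (C : D →+* D[X]) ∧ v ∈ degreeLT D W.natDegree ∧
      x0 - W = x0 * α + v + X ^ k * q := by
  have hN := nak K hK (X ^ k) (monic_X_pow k)
    ((⊤ : Submodule D D[X]).map (LinearMap.mulLeft D x0) ⊔ degreeLT D W.natDegree ⊔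
      (⊤ : Submodule D D[X]).map (LinearMap.mulLeft D (X ^ k)))
    (fun g => Submodule.mem_sup_right ⟨g, trivial, rfl⟩) (by
      intro f
      have e : f = (x0 * (f /ₘ W) + f %ₘ W + X ^ k * 0) + (- (f /ₘ W)) * (x0 - W) := by
        conv_lhs => rw [← modByMonic_add_div f W]
        ring
      rw [e]
      refine Submodule.add_mem_sup (Submodule.add_mem_sup (Submodule.add_mem_sup
        ⟨_, trivial, rfl⟩ ?_) ⟨_, trivial, rfl⟩) ((smulTop K _).2 (Ideal.mul_mem_left _ _ hx))
      rw [mem_degreeLT]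
      rcases subsingleton_or_nontrivial D with hs | hs
      · rw [Subsingleton.elim (f %ₘ W) 0]; simp
      exact (degree_modByMonic_lt f hW).trans_le degree_le_natDegree)
  have h1 := (smulTop K _).2 hx
  rw [← hN, Submodule.smul_sup, Submodule.smul_sup, ← Submodule.map_smul'',
    ← Submodule.map_smul''] at h1
  obtain ⟨a, ha, b, ⟨q, hq, rfl⟩, e⟩ := Submodule.mem_sup.1 h1
  obtain ⟨c, ⟨α, hα, rfl⟩, v, hv, rfl⟩ := Submodule.mem_sup.1 ha
  exact ⟨α, v, q, (smulTop K _).1 hα, (smulTop K _).1 (Submodule.smul_mono le_rfl le_top hv),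
    (smulTop K _).1 hq, Submodule.smul_le_right hv, e.symm⟩

theorem core {D : Type} [CommRing D] (K : Ideal D) (hK : K ≤ Ideal.jacobson ⊥) (r k : ℕ)
    (x y : Fin (r + 1) → D[X]) (θ W : D[X]) (hW : W.Monic)
    (hxy : ∑ i, x i * y i = X ^ k * θ) (hθ : θ - 1 ∈ K.map (C : D →+* D[X]))
    (hx : x 0 - W ∈ K.map (C : D →+* D[X])) :
    ∃ w : D[X], w.Monic ∧ w.natDegree = W.natDegree ∧ w - W ∈ K.map (C : D →+* D[X]) ∧
      ∃ q : Fin (r + 1) → D[X], ∑ i, (if i = 0 then w else x i %ₘ w) * q i = X ^ k := by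
  rcases subsingleton_or_nontrivial D with hs | hs
  · exact ⟨W, hW, rfl, by simp, 0, Subsingleton.elim _ _⟩
  obtain ⟨α, v, q, hα, hv, hq, hvd, e⟩ := weier K hK W (x 0) hW k hx
  have hvd' : v.degree < W.degree := by
    rw [degree_eq_natDegree hW.ne_zero]; exact mem_degreeLT.1 hvd
  have hw : (W + v).Monic := hW.add_of_left hvd'
  have hN := nak K hK (W + v) hw
    ((⊤ : Submodule D D[X]).map (LinearMap.mulLeft D ((1 - α) * θ - q * y 0)) ⊔
      (⊤ : Submodule D D[X]).map (LinearMap.mulLeft D (W + v)))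
    (fun g => Submodule.mem_sup_right ⟨g, trivial, rfl⟩) (by
      intro f
      have e : f = (((1 - α) * θ - q * y 0) * f + (W + v) * 0) +
          (-f * (θ - 1) + f * θ * α + f * y 0 * q) := by ring
      rw [e]
      refine Submodule.add_mem_sup (Submodule.add_mem_sup
        ⟨_, trivial, rfl⟩ ⟨_, trivial, rfl⟩) ((smulTop K _).2 ?_)
      exact add_mem (add_mem (Ideal.mul_mem_left _ _ hθ) (Ideal.mul_mem_left _ _ hα))
        (Ideal.mul_mem_left _ _ hq))
  refine ⟨W + v, hw, natDegree_add_eq_left_of_degree_lt hvd', by simpa using hv, ?_⟩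
  have h1 : (1 : D[X]) ∈ (⊤ : Submodule D D[X]) := trivial
  rw [← hN] at h1
  obtain ⟨_, ⟨f, -, rfl⟩, _, ⟨g, -, rfl⟩, e1⟩ := Submodule.mem_sup.1 h1
  simp only [LinearMap.mulLeft_apply] at e1
  rw [Fin.sum_univ_succ] at hxy
  refine ⟨Fin.cons (X ^ k * g + f * y 0 + f * (1 - α) * ∑ i : Fin r, (x i.succ /ₘ (W + v)) * y i.succ)
    (fun i => f * (1 - α) * y i.succ), ?_⟩
  rw [Fin.sum_univ_succ]
  simp only [Fin.cons_zero, Fin.cons_succ, Fin.succ_ne_zero, if_true, if_false]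
  have e2 : ∑ i : Fin r, x i.succ * y i.succ = ∑ i : Fin r, (x i.succ %ₘ (W+v)) * y i.succ
      + (W + v) * ∑ i : Fin r, (x i.succ /ₘ (W + v)) * y i.succ := by
    rw [Finset.mul_sum, ← Finset.sum_add_distrib]
    refine Finset.sum_congr rfl fun i _ => ?_
    conv_lhs => rw [← modByMonic_add_div (x i.succ) (W + v)]
    ring
  have e3 : ∑ i : Fin r, (x i.succ %ₘ (W+v)) * (f * (1 - α) * y i.succ) =
    f * (1 - α) * ∑ i : Fin r, (x i.succ %ₘ (W+v)) * y i.succ := by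
    rw [Finset.mul_sum]; exact Finset.sum_congr rfl fun i _ => by ring
  rw [e3]
  rw [e2] at hxy
  linear_combination f * (1 - α) * hxy + (-(f * y 0)) * e + X ^ k * e1

theorem lem2 {D A : Type} [CommRing D] [CommRing A] [Nontrivial A] (ψ : D →+* A)
    (hψ : ∀ z, ψ z = 1 → IsUnit z) (r d : ℕ) (b c : Fin (r + 1) → A[X])
    (hbc : ∑ i, b i * c i = 1) (hb : ∀ i, (b i).natDegree ≤ d) (hc : ∀ i, (c i).natDegree ≤ d)
    (hb0 : ∀ i, (b i).eval 0 = if i = 0 then 1 else 0)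
    (x y : Fin (r + 1) → D[X]) (hx : ∀ i, (x i).map ψ = reflect d (b i))
    (hy : ∀ i, (y i).map ψ = reflect d (c i)) (hxy : X ^ (d + d) ∣ ∑ i, x i * y i) :
    ∃ β : Fin (r + 1) → D[X], IsUnimodular β ∧ (∀ i, (β i).eval 0 = if i = 0 then 1 else 0) ∧
      ∀ i, (β i).map ψ = b i := by
  have : Nontrivial D := ψ.domain_nontrivial
  have hK : RingHom.ker ψ ≤ Ideal.jacobson ⊥ := by
    intro z hz
    rw [Ideal.mem_jacobson_bot]
    intro y
    apply hψ
    rw [RingHom.mem_ker] at hz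
    simp [hz]
  have hmem : ∀ f : D[X], f ∈ (RingHom.ker ψ).map (C : D →+* D[X]) ↔ f.map ψ = 0 := by
    intro f
    rw [← ker_mapRingHom]; rfl
  obtain ⟨θ, hθ⟩ := hxy
  have hθ1 : θ.map ψ = 1 := by
    have h1 := congrArg (Polynomial.map ψ) hθ
    rw [Polynomial.map_sum] at h1
    simp only [Polynomial.map_mul, hx, hy, Polynomial.map_pow, map_X] at h1
    have h2 := congrArg (reflect (d + d)) hbc
    have h3 : reflect (d + d) (∑ i, b i * c i) = ∑ i, reflect d (b i) * reflect d (c i) := by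
      have : ∀ s : Finset (Fin (r+1)), reflect (d + d) (∑ i ∈ s, b i * c i) =
          ∑ i ∈ s, reflect d (b i) * reflect d (c i) := by
        intro s
        induction s using Finset.induction_on with
        | empty => simp
        | insert i s hi ih =>
          rw [Finset.sum_insert hi, Finset.sum_insert hi, reflect_add, ih,
            reflect_mul _ _ (hb i) (hc i)]
      exact this _
    rw [h3, h1] at h2
    have h4 : reflect (d + d) (1 : A[X]) = X ^ (d + d) := by
      simp
    rw [h4] at h2
    have := (monic_X_pow (R := A) (d + d)).isRegular.left (h2.trans (mul_one _).symm)
    exact this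
  have hcoef : ∀ i, (reflect d (b i)).coeff d = if i = 0 then 1 else 0 := by
    intro i
    rw [coeff_reflect, revAt_le le_rfl, Nat.sub_self, coeff_zero_eq_eval_zero, hb0]
  have hdeg : ∀ i, (reflect d (b i)).natDegree ≤ d := fun i =>
    natDegree_reflect_le.trans (by simp [hb i])
  have hmon : (reflect d (b 0)).Monic := monic_of_natDegree_le_of_coeff_eq_one d (hdeg 0) (by simp [hcoef])
  have hnd : (reflect d (b 0)).natDegree = d :=
    natDegree_eq_of_le_of_coeff_ne_zero (hdeg 0) (by simp [hcoef])
  have hltX : (x 0 %ₘ X ^ d).degree < (X ^ d : D[X]).degree :=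
    degree_modByMonic_lt _ (monic_X_pow d)
  have hW : (X ^ d + x 0 %ₘ X ^ d).Monic := (monic_X_pow d).add_of_left hltX
  have hWd : (X ^ d + x 0 %ₘ X ^ d).natDegree = d := by
    rw [natDegree_add_eq_left_of_degree_lt hltX, natDegree_X_pow]
  have hWmap : (X ^ d + x 0 %ₘ X ^ d).map ψ = reflect d (b 0) := by
    rw [Polynomial.map_add, map_modByMonic _ (monic_X_pow d), hx]
    simp only [Polynomial.map_pow, map_X]
    have := (div_modByMonic_unique (f := reflect d (b 0)) (g := X ^ d) 1 (reflect d (b 0) - X ^ d)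
      (monic_X_pow d) ⟨by ring, by
        have hdd : (reflect d (b 0)).degree = (X ^ d : A[X]).degree := by
          rw [degree_eq_natDegree hmon.ne_zero, hnd, degree_X_pow]
        exact degree_sub_lt_right hdd (monic_X_pow d).ne_zero
          (by rw [hmon.leadingCoeff, (monic_X_pow d).leadingCoeff])⟩).2
    rw [this]; ring
  obtain ⟨w, hw, hwd, hwW, q, hq⟩ := core (RingHom.ker ψ) hK r (d + d) x y θ _ hW hθ
    (by rw [hmem]; simp [hθ1]) (by rw [hmem, Polynomial.map_sub, hWmap, hx, sub_self])
  rw [hWd] at hwd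
  have hwmap : w.map ψ = reflect d (b 0) := by
    rw [hmem, Polynomial.map_sub, sub_eq_zero] at hwW
    rw [hwW, hWmap]
  set z : Fin (r + 1) → D[X] := fun i => if i = 0 then w else x i %ₘ w with hz
  have hzd : ∀ i, (z i).natDegree ≤ d := by
    intro i
    by_cases hi : i = 0
    · simp [hz, hi, hwd]
    · simp only [hz, hi, if_false]
      rw [← hwd]
      exact natDegree_modByMonic_le _ hw
  have hzc : ∀ i, (z i).coeff d = if i = 0 then 1 else 0 := by
    intro i
    by_cases hi : i = 0
    · simp only [hz, hi, if_true]
      rw [← hwd]; exact hw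
    · simp only [hz, hi, if_false]
      apply coeff_eq_zero_of_degree_lt
      refine (degree_modByMonic_lt _ hw).trans_le ?_
      rw [← hwd]; exact degree_le_natDegree
  refine ⟨fun i => reflect d (z i), ?_, ?_, ?_⟩
  · set I := Ideal.span (Set.range fun i => reflect d (z i)) with hI
    have hmI : ∀ i, reflect d (z i) ∈ I := fun i => Ideal.subset_span ⟨i, rfl⟩
    obtain ⟨m, hm⟩ : ∃ m, d + d ≤ d + m ∧ ∀ i, (q i).natDegree ≤ m := by
      refine ⟨d + ∑ i, (q i).natDegree, by omega, fun i => ?_⟩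
      have := Finset.single_le_sum (f := fun i => (q i).natDegree) (fun _ _ => Nat.zero_le _)
        (Finset.mem_univ i)
      exact this.trans (Nat.le_add_left _ _)
    have h1 : ∀ s : Finset (Fin (r+1)), reflect (d + m) (∑ i ∈ s, z i * q i) ∈ I := by
      intro s
      induction s using Finset.induction_on with
      | empty => simp
      | insert i s hi ih =>
        rw [Finset.sum_insert hi, reflect_add, reflect_mul _ _ (hzd i) (hm.2 i)]
        exact add_mem (Ideal.mul_mem_right _ _ (hmI i)) ih
    have h2 := h1 Finset.univ
    rw [hq] at h2
    have h3 : reflect (d + m) (X ^ (d + d) : D[X]) = X ^ (d + m - (d + d)) := by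
      rw [← one_mul (X ^ (d + d)), ← C_1, reflect_C_mul_X_pow, revAt_le hm.1]
      simp
    rw [h3] at h2
    obtain ⟨g, hg⟩ : (X : D[X]) ∣ reflect d (z 0) - 1 := by
      rw [X_dvd_iff, coeff_sub, coeff_reflect, revAt_le (Nat.zero_le _)]
      simp [hzc]
    have hcop : IsCoprime (reflect d (z 0)) (X ^ (d + m - (d + d))) := by
      apply IsCoprime.pow_right
      exact ⟨1, -g, by linear_combination hg⟩
    obtain ⟨u, v, huv⟩ := hcop
    rw [IsUnimodular, Ideal.eq_top_iff_one, ← huv]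
    exact add_mem (Ideal.mul_mem_left _ _ (hmI 0)) (Ideal.mul_mem_left _ _ h2)
  · intro i
    rw [← coeff_zero_eq_eval_zero, coeff_reflect, revAt_le (Nat.zero_le _), Nat.sub_zero, hzc]
  · intro i
    have : (z i).map ψ = reflect d (b i) := by
      by_cases hi : i = 0
      · simp only [hz, hi, if_true, hwmap]
      · simp only [hz, hi, if_false]
        rw [map_modByMonic _ hw, hx, hwmap, modByMonic_eq_self_iff hmon]
        rw [degree_eq_natDegree hmon.ne_zero, hnd, degree_lt_iff_coeff_zero]
        intro m hm
        rcases hm.eq_or_lt with rfl | hm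
        · simp [hcoef, hi]
        · exact coeff_eq_zero_of_natDegree_lt ((hdeg i).trans_lt hm)
    rw [← reflect_map, this]
    exact reflect_reflect

theorem unimod_iff {A : Type} [CommRing A] {n : ℕ} (v : Fin n → A) :
    IsUnimodular v ↔ ∃ c : Fin n → A, ∑ i, c i * v i = 1 := by
  rw [IsUnimodular, Ideal.eq_top_iff_one, Ideal.mem_span_range_iff_exists_fun]

theorem unimod_map {A B : Type} [CommRing A] [CommRing B] {n : ℕ} (f : A →+* B) (v : Fin n → A)
    (h : IsUnimodular v) : IsUnimodular (fun i => f (v i)) := by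
  rw [unimod_iff] at h ⊢
  obtain ⟨c, hc⟩ := h
  exact ⟨fun i => f (c i), by simpa using congrArg f hc⟩

theorem lem3 {B D A : Type} [CommRing B] [CommRing D] [CommRing A] [Algebra B D] (φ : B →+* A)
    (S : Submonoid B) (hS : ∀ s ∈ S, φ s = 1) [IsLocalization S D] (ψ : D →+* A)
    (hψ : ψ.comp (algebraMap B D) = φ) (r : ℕ) (b : Fin (r + 1) → A[X])
    (β : Fin (r + 1) → D[X]) (hβ : IsUnimodular β)
    (hβ0 : ∀ i, (β i).eval 0 = if i = 0 then 1 else 0) (hβb : ∀ i, (β i).map ψ = b i) :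
    ∃ γ : Fin (r + 1) → B[X], IsUnimodular γ ∧ (∀ i, (γ i).eval 0 = if i = 0 then 1 else 0) ∧
      ∀ i, (γ i).map φ = b i := by
  let _ : Algebra B[X] D[X] := (mapRingHom (algebraMap B D)).toAlgebra
  have : IsLocalization (S.map (C : B →+* B[X])) D[X] := Polynomial.isLocalization S D
  obtain ⟨⟨_, s, hs, rfl⟩, hη⟩ := IsLocalization.exist_integer_multiples_of_finite
    (S.map (C : B →+* B[X])) (fun i => (β i).divX)
  choose η hη using hη
  have hη' : ∀ i, (η i).map (algebraMap B D) = C (algebraMap B D s) * (β i).divX := by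
    intro i
    have := hη i
    rw [Algebra.smul_def] at this
    rw [RingHom.algebraMap_toAlgebra] at this
    simpa using this
  let γ : Fin (r + 1) → B[X] := fun i => C (if i = 0 then 1 else 0) + X * (η i).comp (C s * X)
  have hγβ : ∀ i, (γ i).map (algebraMap B D) = (β i).comp (C (algebraMap B D s) * X) := by
    intro i
    have e1 : β i = X * (β i).divX + C (if i = 0 then 1 else 0) := by
      rw [← hβ0 i, ← coeff_zero_eq_eval_zero, X_mul_divX_add]
    conv_rhs => rw [e1]
    simp only [γ, Polynomial.map_add, Polynomial.map_mul, map_X, map_C, Polynomial.map_comp, hη']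
    simp only [add_comp, mul_comp, X_comp, C_comp]
    split_ifs <;> simp <;> ring
  have hγ0 : ∀ i, (γ i).eval 0 = if i = 0 then 1 else 0 := by
    intro i; simp only [γ, eval_add, eval_mul, eval_C, eval_X, zero_mul, add_zero]
  have hmapu : IsUnimodular (fun i => (γ i).map (algebraMap B D)) := by
    have := unimod_map (compRingHom (C (algebraMap B D s) * X)) β hβ
    simp only [hγβ]
    exact this
  have htop : (Ideal.span (Set.range γ)).map (algebraMap B[X] D[X]) = ⊤ := by
    rw [Ideal.map_span, ← Set.range_comp]
    exact hmapu
  have h1 : algebraMap B[X] D[X] 1 ∈ (Ideal.span (Set.range γ)).map (algebraMap B[X] D[X]) := by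
    rw [htop]; trivial
  rw [IsLocalization.algebraMap_mem_map_algebraMap_iff (S.map (C : B →+* B[X]))] at h1
  obtain ⟨_, ⟨s2, hs2, rfl⟩, h2⟩ := h1
  rw [mul_one, Ideal.mem_span_range_iff_exists_fun] at h2
  obtain ⟨c, hc⟩ := h2
  refine ⟨fun i => (γ i).comp (C s2 * X), ?_, ?_, ?_⟩
  · have hmI : ∀ i, (γ i).comp (C s2 * X) ∈ Ideal.span (Set.range fun i => (γ i).comp (C s2 * X)) :=
      fun i => Ideal.subset_span ⟨i, rfl⟩
    have h3 : (C s2 : B[X]) ∈ Ideal.span (Set.range fun i => (γ i).comp (C s2 * X)) := by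
      have h4 := congrArg (compRingHom (C s2 * X)) hc
      rw [map_sum] at h4
      have h5 : compRingHom (C s2 * X) (C s2 : B[X]) = C s2 := by simp
      have h6 : ∑ i, compRingHom (C s2 * X) (c i * γ i) = C s2 := h4.trans h5
      have h7 : ∑ i, compRingHom (C s2 * X) (c i * γ i) ∈
          Ideal.span (Set.range fun i => (γ i).comp (C s2 * X)) := by
        refine Ideal.sum_mem _ fun i _ => ?_
        rw [map_mul]
        exact Ideal.mul_mem_left _ _ (hmI i)
      rwa [h6] at h7
    rw [IsUnimodular, Ideal.eq_top_iff_one]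
    have h6 : (1 : B[X]) = (γ 0).comp (C s2 * X) - (X * ((η 0).comp (C s * X)).comp (C s2 * X)) * C s2 := by
      simp [γ]; ring
    rw [h6]
    exact sub_mem (hmI 0) (Ideal.mul_mem_left _ _ h3)
  · intro i
    simp only [eval_comp, eval_mul, eval_C, eval_X, mul_zero, hγ0]
  · intro i
    have h7 : (γ i).map φ = b i := by
      rw [← hψ, ← Polynomial.map_map, hγβ, Polynomial.map_comp, hβb]
      have : ψ (algebraMap B D s) = 1 := by
        rw [← hS s hs, ← hψ]; rfl
      simp [this]
    rw [Polynomial.map_comp, h7]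
    simp [hS s2 hs2]

theorem lem4 {B A : Type} [CommRing B] [CommRing A] [Nontrivial A] (φ : B →+* A)
    (r d : ℕ) (b c : Fin (r + 1) → A[X])
    (hbc : ∑ i, b i * c i = 1) (hb : ∀ i, (b i).natDegree ≤ d) (hc : ∀ i, (c i).natDegree ≤ d)
    (hb0 : ∀ i, (b i).eval 0 = if i = 0 then 1 else 0)
    (x y : Fin (r + 1) → B[X]) (hx : ∀ i, (x i).map φ = reflect d (b i))
    (hy : ∀ i, (y i).map φ = reflect d (c i)) (hxy : X ^ (d + d) ∣ ∑ i, x i * y i) :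
    ∃ γ : Fin (r + 1) → B[X], IsUnimodular γ ∧ (∀ i, (γ i).eval 0 = if i = 0 then 1 else 0) ∧
      ∀ i, (γ i).map φ = b i := by
  let S : Submonoid B := (⊥ : Submonoid A).comap φ
  have hS : ∀ s ∈ S, φ s = 1 := fun s hs => by simpa [S] using hs
  let ψ : Localization S →+* A := IsLocalization.lift (M := S) (g := φ)
    (fun s => by rw [hS s s.2]; exact isUnit_one)
  have hψ : ψ.comp (algebraMap B (Localization S)) = φ := IsLocalization.lift_comp _
  have hψ' : ∀ z, ψ z = 1 → IsUnit z := by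
    intro z hz
    obtain ⟨⟨n, s⟩, e⟩ := IsLocalization.surj S z
    have e' := congrArg ψ e
    have h0 : ∀ n, ψ (algebraMap B (Localization S) n) = φ n := fun n => by rw [← hψ]; rfl
    simp only [map_mul, h0, hz, hS s s.2, mul_one] at e'
    have hn : n ∈ S := by simp [S, ← e']
    have := IsLocalization.map_units (Localization S) (⟨n, hn⟩ : S)
    exact isUnit_of_mul_isUnit_left (e ▸ this)
  obtain ⟨β, h1, h2, h3⟩ := lem2 ψ hψ' r d b c hbc hb hc hb0
    (fun i => (x i).map (algebraMap B (Localization S)))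
    (fun i => (y i).map (algebraMap B (Localization S)))
    (fun i => by rw [Polynomial.map_map, hψ, hx])
    (fun i => by rw [Polynomial.map_map, hψ, hy])
    (by
      have := map_dvd (mapRingHom (algebraMap B (Localization S))) hxy
      simpa [Polynomial.map_sum] using this)
  exact lem3 φ S hS ψ hψ r b β h1 h2 h3

theorem lem5 {B A : Type} [CommRing B] [CommRing A] [Nontrivial A] (φ : B →+* A)
    (r d : ℕ) (b c : Fin (r + 1) → A[X])
    (hbc : ∑ i, b i * c i = 1) (hbd : ∀ i, (b i).natDegree ≤ d) (hcd : ∀ i, (c i).natDegree ≤ d)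
    (hb0 : ∀ i, (b i).eval 0 = if i = 0 then 1 else 0)
    (xx yy : Fin (r + 1) → Fin (d + d + 1) → B)
    (hx : ∀ i j, φ (xx i j) = (reflect d (b i)).coeff j)
    (hy : ∀ i j, φ (yy i j) = (reflect d (c i)).coeff j)
    (hrel : ∀ (m : ℕ) (hm : m < d + d), ∑ i, ∑ j : Fin (m + 1),
      xx i ⟨j.1, by have := j.2; omega⟩ * yy i ⟨m - j.1, by omega⟩ = 0) :
    ∃ γ : Fin (r + 1) → B[X], IsUnimodular γ ∧ (∀ i, (γ i).eval 0 = if i = 0 then 1 else 0) ∧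
      ∀ i, (γ i).map φ = b i := by
  have hrd : ∀ f : A[X], f.natDegree ≤ d → (reflect d f).natDegree ≤ d := fun f hf =>
    natDegree_reflect_le.trans (by simp [hf])
  have hcoe : ∀ {T : Type} [CommRing T] (f : Fin (d + d + 1) → T) (m : ℕ),
      (∑ j : Fin (d + d + 1), C (f j) * X ^ (j : ℕ)).coeff m =
        if hm : m < d + d + 1 then f ⟨m, hm⟩ else 0 := by
    intro T _ f m
    rw [finsetSum_coeff]
    simp only [coeff_C_mul_X_pow]
    split_ifs with hm
    · rw [Finset.sum_eq_single ⟨m, hm⟩]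
      · simp
      · intro j _ hj
        rw [if_neg]
        rintro rfl
        exact hj rfl
      · simp
    · refine Finset.sum_eq_zero fun j _ => ?_
      rw [if_neg]
      have := j.2
      omega
  have hmap : ∀ (f : A[X]), f.natDegree ≤ d →
      ∑ j : Fin (d + d + 1), C (f.coeff j) * X ^ (j : ℕ) = f := by
    intro f hf
    ext m
    rw [hcoe (fun j : Fin (d + d + 1) => f.coeff j)]
    split_ifs with hm
    · rfl
    · rw [coeff_eq_zero_of_natDegree_lt]; omega
  apply lem4 φ r d b c hbc hbd hcd hb0
    (fun i => ∑ j : Fin (d + d + 1), C (xx i j) * X ^ (j : ℕ))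
    (fun i => ∑ j : Fin (d + d + 1), C (yy i j) * X ^ (j : ℕ))
  · intro i
    simp only [Polynomial.map_sum, Polynomial.map_mul, map_C, Polynomial.map_pow, map_X, hx]
    exact hmap _ (hrd _ (hbd i))
  · intro i
    simp only [Polynomial.map_sum, Polynomial.map_mul, map_C, Polynomial.map_pow, map_X, hy]
    exact hmap _ (hrd _ (hcd i))
  · rw [X_pow_dvd_iff]
    intro m hm
    rw [← hrel m hm, finsetSum_coeff]
    refine Finset.sum_congr rfl fun i _ => ?_
    rw [coeff_mul, Finset.Nat.sum_antidiagonal_eq_sum_range_succ_mk, Finset.sum_range]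
    refine Finset.sum_congr rfl fun j _ => ?_
    have hj := j.2
    rw [hcoe (xx i), hcoe (yy i), dif_pos (by omega), dif_pos (by omega)]

theorem suslin_completable_of_testRings (r : ℕ) (hr : 2 ≤ r)
    (h : ∀ k n : ℕ,
      ∀ a : Fin (r + 1) → Polynomial (BFin (Localization.Away ((Nat.factorial r : ℤ))) r k n),
        IsUnimodular a → (∀ i, (a i).eval 0 = if i = 0 then 1 else 0) → IsCompletable a) :
    ∀ (A : Type) [CommRing A] [Algebra (Localization.Away ((Nat.factorial r : ℤ))) A],
      ∀ b : Fin (r + 1) → Polynomial A, IsUnimodular b →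
        (∀ i, (b i).eval 0 = if i = 0 then 1 else 0) → IsCompletable b := by
  intro A _ _ b hb hb0
  rcases subsingleton_or_nontrivial A with hs | hs
  · exact ⟨1, isUnit_one, 0, Subsingleton.elim _ _⟩
  obtain ⟨c, hc⟩ := (unimod_iff b).1 hb
  have hbc : ∑ i, b i * c i = 1 := by simpa only [mul_comm] using hc
  let d := ∑ i, ((b i).natDegree + (c i).natDegree)
  have hd : ∀ i, (b i).natDegree + (c i).natDegree ≤ d := fun i =>
    Finset.single_le_sum (f := fun i => (b i).natDegree + (c i).natDegree)
      (fun _ _ => Nat.zero_le _) (Finset.mem_univ i)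
  have hbd : ∀ i, (b i).natDegree ≤ d := fun i => (Nat.le_add_right _ _).trans (hd i)
  have hcd : ∀ i, (c i).natDegree ≤ d := fun i => (Nat.le_add_left _ _).trans (hd i)
  let R := Localization.Away ((Nat.factorial r : ℤ))
  let g : FinVars r (d + d) → A := Sum.elim (fun p => (reflect d (b p.1)).coeff p.2)
    (fun p => (reflect d (c p.1)).coeff p.2)
  have hrd : ∀ f : A[X], f.natDegree ≤ d → (reflect d f).natDegree ≤ d := fun f hf =>
    natDegree_reflect_le.trans (by simp [hf])
  have hsum : ∑ i, reflect d (b i) * reflect d (c i) = X ^ (d + d) := by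
    rw [← reflect_one, ← hbc]
    have : ∀ s : Finset (Fin (r+1)), reflect (d + d) (∑ i ∈ s, b i * c i) =
        ∑ i ∈ s, reflect d (b i) * reflect d (c i) := by
      intro s
      induction s using Finset.induction_on with
      | empty => simp
      | insert i s hi ih =>
        rw [Finset.sum_insert hi, Finset.sum_insert hi, reflect_add, ih,
          reflect_mul _ _ (hbd i) (hcd i)]
    exact (this _).symm
  have hp : ∀ ℓ : Fin (d + d + 1), MvPolynomial.aeval (R := R) g (pFin R r (d + d) ℓ) =
      (X ^ (d + d) : A[X]).coeff ℓ := by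
    intro ℓ
    rw [← hsum, finsetSum_coeff]
    simp only [pFin, map_sum, map_mul, MvPolynomial.aeval_X, g, Sum.elim_inl, Sum.elim_inr]
    refine Finset.sum_congr rfl fun i _ => ?_
    rw [coeff_mul, Finset.Nat.sum_antidiagonal_eq_sum_range_succ_mk, Finset.sum_range]
  have hJ : ∀ a ∈ JFin R r (d + d) (d + d), MvPolynomial.aeval (R := R) g a = 0 := by
    intro a ha
    have : JFin R r (d + d) (d + d) ≤ RingHom.ker (MvPolynomial.aeval (R := R) g) := by
      rw [JFin, Ideal.span_le]
      rintro _ ⟨ℓ, hℓ, rfl⟩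
      change MvPolynomial.aeval (R := R) g _ = 0
      rw [hp, coeff_X_pow, if_neg hℓ]
    exact this ha
  let π : MvPolynomial (FinVars r (d + d)) R →+* BFin R r (d + d) (d + d) :=
    Ideal.Quotient.mk (JFin R r (d + d) (d + d))
  let φ : BFin R r (d + d) (d + d) →+* A :=
    Ideal.Quotient.lift (JFin R r (d + d) (d + d))
      (MvPolynomial.aeval (R := R) g : MvPolynomial (FinVars r (d + d)) R →ₐ[R] A).toRingHom hJ
  have hφ : ∀ v, φ (π (MvPolynomial.X v)) = g v := by
    intro v
    change MvPolynomial.aeval (R := R) g (MvPolynomial.X v) = g v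
    simp
  have hπ : ∀ ℓ : Fin (d + d + 1), (ℓ : ℕ) ≠ d + d → π (pFin R r (d + d) ℓ) = 0 := by
    intro ℓ hℓ
    exact Ideal.Quotient.eq_zero_iff_mem.2 (Ideal.subset_span ⟨ℓ, hℓ, rfl⟩)
  obtain ⟨γ, h1, h2, h3⟩ := lem5 φ r d b c hbc hbd hcd hb0
    (fun i j => π (MvPolynomial.X (Sum.inl (i, j)))) (fun i j => π (MvPolynomial.X (Sum.inr (i, j))))
    (fun i j => hφ _) (fun i j => hφ _)
    (by
      intro m hm
      have := hπ ⟨m, by omega⟩ hm.ne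
      rw [pFin, map_sum] at this
      simp only [map_sum, map_mul] at this
      exact this)
  obtain ⟨M, hM, i, hi⟩ := h _ _ γ h1 h2
  refine ⟨M.map (mapRingHom φ), ?_, i, ?_⟩
  · have := hM.map (mapRingHom φ).mapMatrix
    simpa using this
  · ext1 j
    rw [← h3 j, ← hi]
    rfl
end
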